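/- For every real number x with |x| < log 2, one has Σ_{ω=0}^∞ (x^ω/ω!) · (Σ_{i=1}^∞ i^ω/2^i) = e^x/(2 − e^x), where all series involved converge. -/

import Mathlib

lemma inner_hasSum (y : ℝ) (i : ℕ) :
    HasSum (fun w : ℕ => y ^ w / (w.factorial : ℝ) * (((i : ℝ) + 1) ^ w / 2 ^ (i + 1)))
      ((Real.exp y / 2) ^ (i + 1)) := by
  have h := NormedSpace.expSeries_div_hasSum_exp (y * ((i : ℝ) + 1))
  rw [← Real.exp_eq_exp_ℝ] at h
  have h2 := h.div_const ((2 : ℝ) ^ (i + 1))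
  convert h2 using 1
  · rfl
  · funext w
    rw [mul_pow]
    ring
  · rw [div_pow, ← Real.exp_nat_mul]
    push_cast
    rw [mul_comm y]

lemma exp_lt_two (y : ℝ) (hy : |y| < Real.log 2) : Real.exp y < 2 := by
  rw [← Real.lt_log_iff_exp_lt (by norm_num)]
  exact lt_of_le_of_lt (le_abs_self y) hy

lemma outer_hasSum (y : ℝ) (hy : |y| < Real.log 2) :
    HasSum (fun i : ℕ => (Real.exp y / 2) ^ (i + 1)) (Real.exp y / (2 - Real.exp y)) := by
  have h2 := exp_lt_two y hy
  have h0 := Real.exp_pos y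
  have h := (hasSum_geometric_of_lt_one (r := Real.exp y / 2) (by positivity)
    (by linarith)).mul_left (Real.exp y / 2)
  convert h using 1
  · rfl
  · funext i
    ring
  · have : 2 - Real.exp y ≠ 0 := by linarith
    have : 1 - Real.exp y / 2 ≠ 0 := by intro h; apply this; linarith
    field_simp

/-- Exponential generating function: for `|x| < log 2`,
`Σ_{ω=0}^∞ (x^ω/ω!) Σ_{i=1}^∞ i^ω/2^i = e^x/(2 − e^x)`, all series converging. -/
theorem egf_polylog (x : ℝ) (hx : |x| < Real.log 2) :
    (∀ w : ℕ, Summable (fun i : ℕ => ((i : ℝ) + 1) ^ w / 2 ^ (i + 1))) ∧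
    Summable (fun w : ℕ =>
      x ^ w / (w.factorial : ℝ) * ∑' i : ℕ, ((i : ℝ) + 1) ^ w / 2 ^ (i + 1)) ∧
    ∑' w : ℕ, x ^ w / (w.factorial : ℝ) * ∑' i : ℕ, ((i : ℝ) + 1) ^ w / 2 ^ (i + 1)
      = Real.exp x / (2 - Real.exp x) := by
  have h1 : ∀ w : ℕ, Summable (fun i : ℕ => ((i : ℝ) + 1) ^ w / 2 ^ (i + 1)) := by
    intro w
    have h := summable_pow_mul_geometric_of_norm_lt_one (R := ℝ) w (r := 1 / 2) (by norm_num)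
    have h' := (summable_nat_add_iff 1).2 h
    refine h'.congr ?_
    intro i
    push_cast
    rw [one_div, inv_pow]
    ring
  have hs : Summable (fun p : ℕ × ℕ =>
      x ^ p.2 / (p.2.factorial : ℝ) * (((p.1 : ℝ) + 1) ^ p.2 / 2 ^ (p.1 + 1))) := by
    have habs : Summable (fun p : ℕ × ℕ =>
        |x| ^ p.2 / (p.2.factorial : ℝ) * (((p.1 : ℝ) + 1) ^ p.2 / 2 ^ (p.1 + 1))) := by
      rw [summable_prod_of_nonneg (fun p => by positivity)]
      refine ⟨fun i => (inner_hasSum |x| i).summable, ?_⟩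
      simp only [(inner_hasSum |x| _).tsum_eq]
      exact (outer_hasSum |x| (by rwa [abs_abs])).summable
    refine Summable.of_norm (habs.congr ?_)
    intro p
    have hp : (0 : ℝ) ≤ ((p.1 : ℝ) + 1) ^ p.2 / 2 ^ (p.1 + 1) := by positivity
    rw [Real.norm_eq_abs, abs_mul, abs_div, abs_pow, abs_of_nonneg hp, Nat.abs_cast]
  have hsum : HasSum (fun p : ℕ × ℕ =>
      x ^ p.2 / (p.2.factorial : ℝ) * (((p.1 : ℝ) + 1) ^ p.2 / 2 ^ (p.1 + 1)))
      (Real.exp x / (2 - Real.exp x)) := by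
    have h := hs.hasSum.prod_fiberwise (fun i => inner_hasSum x i)
    rw [← h.unique (outer_hasSum x hx)]
    exact hs.hasSum
  have hswap := (Equiv.prodComm ℕ ℕ).hasSum_iff.2 hsum
  have hfin := hswap.prod_fiberwise (fun w => ((h1 w).hasSum.mul_left (x ^ w / (w.factorial : ℝ))))
  exact ⟨h1, hfin.summable, hfin.tsum_eq⟩
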